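/- arXiv:math/0407520 — 3 statements merged into one kernel-verified Lean document; each statement's English description precedes it below -/
import Mathlib

section
/- Fix 1 < p ≤ 2 and let x, y, z, w ∈ L_p. Then ‖y−z‖_p² + (p−1)‖x−w‖_p² ≤ ‖x−y‖_p² + ‖y−w‖_p² + ‖w−z‖_p² + ‖z−x‖_p². -/
open MeasureTheory

/-- The binomial lower bound `1 + p (p - 1) / 2 * t ^ 2` for the even part of `(1 + t) ^ p`. -/
lemma one_add_mul_sq_le_mean_rpow {p t : ℝ} (hp1 : 1 < p) (hp2 : p ≤ 2)
    (ht0 : 0 ≤ t) (ht1 : t ≤ 1) :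
    1 + p * (p - 1) / 2 * t ^ 2 ≤ ((1 + t) ^ p + (1 - t) ^ p) / 2 := by
  have hint : interior (Set.Icc (0 : ℝ) 1) = Set.Ioo 0 1 := interior_Icc
  have hd1 : ∀ s ∈ Set.Ioo (0 : ℝ) 1,
      HasDerivAt (fun s : ℝ => (1 + s) ^ (p - 1) - (1 - s) ^ (p - 1) - 2 * (p - 1) * s)
        ((p - 1) * ((1 + s) ^ (p - 2) + (1 - s) ^ (p - 2) - 2)) s := by
    intro s hs
    have h1 := ((hasDerivAt_id s).const_add 1).rpow_const (p := p - 1)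
      (Or.inl (by simp only [id]; linarith [hs.1]))
    have h2 := ((hasDerivAt_id s).const_sub 1).rpow_const (p := p - 1)
      (Or.inl (by simp only [id]; linarith [hs.2]))
    refine ((h1.sub h2).sub ((hasDerivAt_id s).const_mul (2 * (p - 1)))).congr_deriv ?_
    simp only [id, show p - 1 - 1 = p - 2 by ring]
    ring
  have hmono1 : MonotoneOn
      (fun s : ℝ => (1 + s) ^ (p - 1) - (1 - s) ^ (p - 1) - 2 * (p - 1) * s)
      (Set.Icc 0 1) := by
    apply monotoneOn_of_deriv_nonneg (convex_Icc 0 1)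
    · refine ContinuousOn.sub (ContinuousOn.sub ?_ ?_) (by fun_prop)
      · exact ContinuousOn.rpow_const (by fun_prop) fun _ _ => Or.inr (by linarith)
      · exact ContinuousOn.rpow_const (by fun_prop) fun _ _ => Or.inr (by linarith)
    · rw [hint]
      exact fun s hs => (hd1 s hs).differentiableAt.differentiableWithinAt
    · rw [hint]
      intro s hs
      rw [(hd1 s hs).deriv]
      refine mul_nonneg (by linarith) ?_
      have ha : 0 < (1 + s) ^ (p - 2) := Real.rpow_pos_of_pos (by linarith [hs.1]) _
      have hb : 0 < (1 - s) ^ (p - 2) := Real.rpow_pos_of_pos (by linarith [hs.2]) _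
      have hab : 1 ≤ (1 + s) ^ (p - 2) * (1 - s) ^ (p - 2) := by
        rw [← Real.mul_rpow (by linarith [hs.1]) (by linarith [hs.2])]
        exact Real.one_le_rpow_of_pos_of_le_one_of_nonpos
          (mul_pos (by linarith [hs.1]) (by linarith [hs.2])) (by nlinarith [hs.1])
          (by linarith)
      nlinarith [sq_nonneg ((1 + s) ^ (p - 2) - (1 - s) ^ (p - 2))]
  have hd2 : ∀ s ∈ Set.Ioo (0 : ℝ) 1,
      HasDerivAt (fun s : ℝ => (1 + s) ^ p + (1 - s) ^ p - p * (p - 1) * s ^ 2)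
        (p * ((1 + s) ^ (p - 1) - (1 - s) ^ (p - 1) - 2 * (p - 1) * s)) s := by
    intro s hs
    have h1 := ((hasDerivAt_id s).const_add 1).rpow_const (p := p) (Or.inr hp1.le)
    have h2 := ((hasDerivAt_id s).const_sub 1).rpow_const (p := p) (Or.inr hp1.le)
    refine ((h1.add h2).sub ((hasDerivAt_pow 2 s).const_mul (p * (p - 1)))).congr_deriv ?_
    simp only [id]
    push_cast
    ring
  have hmono2 : MonotoneOn
      (fun s : ℝ => (1 + s) ^ p + (1 - s) ^ p - p * (p - 1) * s ^ 2) (Set.Icc 0 1) := by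
    apply monotoneOn_of_deriv_nonneg (convex_Icc 0 1)
    · refine ContinuousOn.sub (ContinuousOn.add ?_ ?_) (by fun_prop)
      · exact ContinuousOn.rpow_const (by fun_prop) fun _ _ => Or.inr (by linarith)
      · exact ContinuousOn.rpow_const (by fun_prop) fun _ _ => Or.inr (by linarith)
    · rw [hint]
      exact fun s hs => (hd2 s hs).differentiableAt.differentiableWithinAt
    · rw [hint]
      intro s hs
      rw [(hd2 s hs).deriv]
      refine mul_nonneg (by linarith) ?_
      have := hmono1 (Set.left_mem_Icc.2 zero_le_one) (Set.Ioo_subset_Icc_self hs) hs.1.le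
      simpa using this
  have := hmono2 (Set.left_mem_Icc.2 zero_le_one) ⟨ht0, ht1⟩ ht0
  simp only [add_zero, sub_zero, Real.one_rpow] at this
  linarith

/-- The two-point inequality, under the assumption `|b| ≤ |a|`. -/
lemma sq_add_mul_sq_rpow_le_of_abs_le {p a b : ℝ} (hp1 : 1 < p) (hp2 : p ≤ 2) (hab : |b| ≤ |a|) :
    (a ^ 2 + (p - 1) * b ^ 2) ^ (p / 2) ≤ (|a + b| ^ p + |a - b| ^ p) / 2 := by
  wlog hb : 0 ≤ b generalizing b
  · have := this (b := -b) (by simpa using hab) (by linarith)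
    simpa [← sub_eq_add_neg, add_comm] using this
  wlog ha : 0 ≤ a generalizing a
  · have := this (a := -a) (by simpa using hab) (by linarith)
    rw [neg_sq, ← abs_neg (-a + b), ← abs_neg (-a - b)] at this
    simpa [add_comm, sub_eq_add_neg] using this
  rw [abs_of_nonneg hb, abs_of_nonneg ha] at hab
  rcases ha.eq_or_lt with rfl | ha
  · obtain rfl : b = 0 := le_antisymm hab hb
    simp [Real.zero_rpow (show p / 2 ≠ 0 by linarith), Real.zero_rpow (show p ≠ 0 by linarith)]
  obtain ⟨t, rfl⟩ : ∃ t, b = a * t := ⟨b / a, by field_simp⟩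
  have ht0 : 0 ≤ t := nonneg_of_mul_nonneg_right hb ha
  have ht1 : t ≤ 1 := by nlinarith
  have hsq : (a ^ 2) ^ (p / 2) = a ^ p := by
    rw [← Real.rpow_natCast, ← Real.rpow_mul ha.le]
    congr 1
    push_cast
    ring
  have h1 : (1 + (p - 1) * t ^ 2) ^ (p / 2) ≤ 1 + p / 2 * ((p - 1) * t ^ 2) :=
    rpow_one_add_le_one_add_mul_self (by nlinarith [sq_nonneg t]) (by linarith) (by linarith)
  have h2 := one_add_mul_sq_le_mean_rpow hp1 hp2 ht0 ht1
  rw [show a ^ 2 + (p - 1) * (a * t) ^ 2 = a ^ 2 * (1 + (p - 1) * t ^ 2) by ring,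
    Real.mul_rpow (sq_nonneg a) (by nlinarith [sq_nonneg t]), hsq,
    show a + a * t = a * (1 + t) by ring, show a - a * t = a * (1 - t) by ring,
    abs_of_nonneg (mul_nonneg ha.le (by linarith)), abs_of_nonneg (mul_nonneg ha.le (by linarith)),
    Real.mul_rpow ha.le (by linarith), Real.mul_rpow ha.le (by linarith), ← mul_add, mul_div_assoc]
  refine mul_le_mul_of_nonneg_left ?_ (Real.rpow_nonneg ha.le p)
  linarith

/-- The **two-point inequality** of Bonami and Gross. -/
lemma sq_add_mul_sq_rpow_le {p : ℝ} (hp1 : 1 < p) (hp2 : p ≤ 2) (a b : ℝ) :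
    (a ^ 2 + (p - 1) * b ^ 2) ^ (p / 2) ≤ (|a + b| ^ p + |a - b| ^ p) / 2 := by
  rcases le_total |b| |a| with h | h
  · exact sq_add_mul_sq_rpow_le_of_abs_le hp1 hp2 h
  · refine le_trans (Real.rpow_le_rpow ?_ ?_ (by linarith))
      ((sq_add_mul_sq_rpow_le_of_abs_le hp1 hp2 h).trans_eq ?_)
    · nlinarith [sq_nonneg a, sq_nonneg b]
    · nlinarith [sq_le_sq.2 h]
    · rw [add_comm b a, abs_sub_comm b a]

/-- Hölder's inequality on a two-point space with weights `1` and `c`, for the exponents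
`2 / p` and `2 / (2 - p)`. -/
lemma abs_rpow_mul_rpow_add_le {p c : ℝ} (hp1 : 0 < p) (hp2 : p ≤ 2) (hc : 0 < c) (a b : ℝ)
    {A B : ℝ} (hA : 0 ≤ A) (hB : 0 ≤ B) (hS : 0 < A ^ 2 + c * B ^ 2) :
    |a| ^ p * A ^ (2 - p) + c * (|b| ^ p * B ^ (2 - p)) ≤
      (A ^ 2 + c * B ^ 2) ^ (1 - p / 2) * (a ^ 2 + c * b ^ 2) ^ (p / 2) := by
  set S := A ^ 2 + c * B ^ 2 with hSdef
  have hX0 : 0 ≤ a ^ 2 + c * b ^ 2 := by positivity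
  rcases hX0.eq_or_lt with hX | hX
  · have ha : a = 0 := by
      have : a ^ 2 = 0 := by nlinarith [sq_nonneg a, mul_nonneg hc.le (sq_nonneg b)]
      simpa using this
    have hb : b = 0 := by
      subst ha
      simpa [hc.ne'] using hX.symm
    subst ha hb
    simp [Real.zero_rpow hp1.ne', Real.zero_rpow (show p / 2 ≠ 0 by linarith)]
  set X := a ^ 2 + c * b ^ 2 with hXdef
  have key : ∀ u U : ℝ, 0 ≤ U → |u| ^ p * U ^ (2 - p) ≤
      (S ^ (1 - p / 2) * X ^ (p / 2)) * (p / 2 * (u ^ 2 / X) + (1 - p / 2) * (U ^ 2 / S)) := by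
    intro u U hU
    have h := Real.geom_mean_le_arith_mean2_weighted (w₁ := p / 2) (w₂ := 1 - p / 2)
      (by linarith) (by linarith) (show 0 ≤ u ^ 2 / X by positivity)
      (show 0 ≤ U ^ 2 / S by positivity) (by ring)
    refine le_trans (le_of_eq ?_) (mul_le_mul_of_nonneg_left h (by positivity))
    rw [Real.div_rpow (sq_nonneg u) hX.le, Real.div_rpow (sq_nonneg U) hS.le, ← sq_abs u,
      ← Real.rpow_natCast |u|, ← Real.rpow_natCast U, ← Real.rpow_mul (abs_nonneg u),
      ← Real.rpow_mul hU, show ((2 : ℕ) : ℝ) * (p / 2) = p by push_cast; ring,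
      show ((2 : ℕ) : ℝ) * (1 - p / 2) = 2 - p by push_cast; ring]
    have := (Real.rpow_pos_of_pos hX (p / 2)).ne'
    have := (Real.rpow_pos_of_pos hS (1 - p / 2)).ne'
    field_simp
  calc _ ≤ _ := add_le_add (key a A hA) (mul_le_mul_of_nonneg_left (key b B hB) hc.le)
    _ = (S ^ (1 - p / 2) * X ^ (p / 2)) *
        (p / 2 * ((a ^ 2 + c * b ^ 2) / X) + (1 - p / 2) * ((A ^ 2 + c * B ^ 2) / S)) := by ring
    _ = _ := by
      rw [← hXdef, ← hSdef, div_self hX.ne', div_self hS.ne']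
      ring

namespace MeasureTheory.Lp

variable {α : Type*} [MeasurableSpace α] {μ : Measure α} {p : ℝ}

lemma integrable_abs_rpow (hp : 0 < p) (f : Lp ℝ (ENNReal.ofReal p) μ) :
    Integrable (fun t => |f t| ^ p) μ := by
  have := (Lp.memLp f).integrable_norm_rpow (by simpa using hp) ENNReal.ofReal_ne_top
  simpa [ENNReal.toReal_ofReal hp.le] using this

lemma norm_rpow_eq_integral_abs (hp : 0 < p) (f : Lp ℝ (ENNReal.ofReal p) μ) :
    ‖f‖ ^ p = ∫ t, |f t| ^ p ∂μ := by
  have h0 : 0 ≤ ∫ t, |f t| ^ p ∂μ := integral_nonneg fun t => by positivity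
  rw [Lp.norm_def, (Lp.memLp f).eLpNorm_eq_integral_rpow_norm (by simpa using hp)
    ENNReal.ofReal_ne_top]
  simp only [ENNReal.toReal_ofReal hp.le, Real.norm_eq_abs]
  rw [ENNReal.toReal_ofReal (by positivity), Real.rpow_inv_rpow h0 hp.ne']

/-- The **Ball–Carlen–Lieb inequality**: `L_p` is `2`-uniformly convex for `1 < p ≤ 2`, with
constant `p - 1`. -/
lemma norm_sq_add_mul_norm_sq_le (hp1 : 1 < p) (hp2 : p ≤ 2) (f g : Lp ℝ (ENNReal.ofReal p) μ) :
    ‖f‖ ^ 2 + (p - 1) * ‖g‖ ^ 2 ≤ (‖f + g‖ ^ 2 + ‖f - g‖ ^ 2) / 2 := by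
  have : Fact (1 ≤ ENNReal.ofReal p) := ⟨by simpa using hp1.le⟩
  have hp0 : 0 < p := by linarith
  have hc : 0 < p - 1 := by linarith
  have hS0 : 0 ≤ ‖f‖ ^ 2 + (p - 1) * ‖g‖ ^ 2 := by positivity
  rcases hS0.eq_or_lt with hS | hS
  · rw [← hS]
    positivity
  have hmul : ∀ h : Lp ℝ (ENNReal.ofReal p) μ, ‖h‖ ^ p * ‖h‖ ^ (2 - p) = ‖h‖ ^ 2 := fun h => by
    rw [← Real.rpow_add_of_nonneg (norm_nonneg h) hp0.le (by linarith),
      show p + (2 - p) = ((2 : ℕ) : ℝ) by push_cast; ring, Real.rpow_natCast]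
  set S := ‖f‖ ^ 2 + (p - 1) * ‖g‖ ^ 2 with hSdef
  set M := (‖f + g‖ ^ p + ‖f - g‖ ^ p) / 2 with hMdef
  have hSM : S ≤ S ^ (1 - p / 2) * M := by
    have hint := integral_mono_ae (μ := μ)
      (f := fun t => |f t| ^ p * ‖f‖ ^ (2 - p) + (p - 1) * (|g t| ^ p * ‖g‖ ^ (2 - p)))
      (g := fun t => S ^ (1 - p / 2) * ((|(f + g) t| ^ p + |(f - g) t| ^ p) / 2))
      (((integrable_abs_rpow hp0 f).mul_const _).add
        (((integrable_abs_rpow hp0 g).mul_const _).const_mul _))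
      ((((integrable_abs_rpow hp0 _).add (integrable_abs_rpow hp0 _)).div_const 2).const_mul _)
      (by
        filter_upwards [Lp.coeFn_add f g, Lp.coeFn_sub f g] with t hadd hsub
        simp only [hadd, hsub, Pi.add_apply, Pi.sub_apply]
        exact (abs_rpow_mul_rpow_add_le hp0 hp2 hc (f t) (g t) (norm_nonneg f) (norm_nonneg g)
          hS).trans (mul_le_mul_of_nonneg_left (sq_add_mul_sq_rpow_le hp1 hp2 _ _) (by positivity)))
    rw [integral_add ((integrable_abs_rpow hp0 f).mul_const _)
        (((integrable_abs_rpow hp0 g).mul_const _).const_mul _),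
      integral_const_mul, integral_const_mul, integral_mul_const, integral_mul_const,
      integral_div, integral_add (integrable_abs_rpow hp0 _) (integrable_abs_rpow hp0 _)] at hint
    simpa only [← norm_rpow_eq_integral_abs hp0, hmul] using hint
  have hSM' : S ^ (p / 2) ≤ M := by
    have hpos := Real.rpow_pos_of_pos hS (1 - p / 2)
    refine le_of_mul_le_mul_left ?_ hpos
    rwa [← Real.rpow_add hS, show 1 - p / 2 + p / 2 = 1 by ring, Real.rpow_one]
  have hroot : ∀ {u : ℝ}, 0 ≤ u → (u ^ p) ^ (2 / p) = u ^ 2 := fun hu => by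
    rw [← Real.rpow_mul hu, mul_div_cancel₀ _ hp0.ne', Real.rpow_two]
  calc S = (S ^ (p / 2)) ^ (2 / p) := by
        rw [← Real.rpow_mul hS0, div_mul_div_cancel₀ two_ne_zero, div_self hp0.ne', Real.rpow_one]
    _ ≤ M ^ (2 / p) := Real.rpow_le_rpow (by positivity) hSM' (by positivity)
    _ = (1 / 2 * ‖f + g‖ ^ p + 1 / 2 * ‖f - g‖ ^ p) ^ (2 / p) := by rw [hMdef]; congr 1; ring
    _ ≤ 1 / 2 * (‖f + g‖ ^ p) ^ (2 / p) + 1 / 2 * (‖f - g‖ ^ p) ^ (2 / p) :=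
        (convexOn_rpow ((one_le_div hp0).2 hp2)).2 (Real.rpow_nonneg (norm_nonneg _) p)
          (Real.rpow_nonneg (norm_nonneg _) p) (by norm_num) (by norm_num) (by norm_num)
    _ = _ := by
        rw [hroot (norm_nonneg _), hroot (norm_nonneg _)]
        ring

end MeasureTheory.Lp

/-- **Four-point inequality in `L_p`, `1 < p ≤ 2`.**
For `x, y, z, w ∈ L_p`:
`‖y−z‖² + (p−1)‖x−w‖² ≤ ‖x−y‖² + ‖y−w‖² + ‖w−z‖² + ‖z−x‖²`. -/
theorem diamond_four_point_inequality
    {α : Type*} [MeasurableSpace α] (μ : Measure α) (p : ℝ)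
    (hp1 : 1 < p) (hp2 : p ≤ 2)
    (x y z w : Lp ℝ (ENNReal.ofReal p) μ) :
    ‖y - z‖ ^ 2 + (p - 1) * ‖x - w‖ ^ 2 ≤
      ‖x - y‖ ^ 2 + ‖y - w‖ ^ 2 + ‖w - z‖ ^ 2 + ‖z - x‖ ^ 2 := by
  have : Fact (1 ≤ ENNReal.ofReal p) := ⟨by simpa using hp1.le⟩
  have key : ∀ v : Lp ℝ (ENNReal.ofReal p) μ,
      ‖y - z‖ ^ 2 + (p - 1) * ‖(y - v) + (z - v)‖ ^ 2 ≤ 2 * (‖y - v‖ ^ 2 + ‖z - v‖ ^ 2) := by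
    intro v
    have h := Lp.norm_sq_add_mul_norm_sq_le hp1 hp2 (y - z) ((y - v) + (z - v))
    rw [show y - z + (y - v + (z - v)) = (2 : ℝ) • (y - v) by rw [two_smul]; abel,
      show y - z - (y - v + (z - v)) = -((2 : ℝ) • (z - v)) by rw [two_smul]; abel,
      norm_neg, norm_smul, norm_smul, Real.norm_ofNat] at h
    linarith
  have htri : 2 * ‖x - w‖ ≤ ‖(y - x) + (z - x)‖ + ‖(y - w) + (z - w)‖ := by
    have h := norm_sub_le ((y - w) + (z - w)) ((y - x) + (z - x))
    rw [show (y - w) + (z - w) - ((y - x) + (z - x)) = (2 : ℝ) • (x - w) by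
      rw [two_smul]; abel, norm_smul, Real.norm_ofNat] at h
    linarith
  have hsq : 2 * ‖x - w‖ ^ 2 ≤
      ‖(y - x) + (z - x)‖ ^ 2 + ‖(y - w) + (z - w)‖ ^ 2 := by
    nlinarith [norm_nonneg (x - w),
      sq_nonneg (‖(y - x) + (z - x)‖ - ‖(y - w) + (z - w)‖)]
  have hx := key x
  have hw := key w
  rw [norm_sub_rev x y, norm_sub_rev w z]
  nlinarith [mul_le_mul_of_nonneg_left hsq (show 0 ≤ p - 1 by linarith)]
end

section
/- For every 1 < p ≤ 2 and every a, b ∈ L_p: ‖a+b‖_p² + (p−1)‖a−b‖_p² ≤ 2(‖a‖_p² + ‖b‖_p²). -/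
open MeasureTheory

theorem two_mul_le_rpow_one_add_sub_rpow_one_sub {r x : ℝ} (hr : 0 < r) (hr1 : r ≤ 1)
    (hx : x ∈ Set.Icc (0 : ℝ) 1) : 2 * r * x ≤ (1 + x) ^ r - (1 - x) ^ r := by
  have hmono : MonotoneOn (fun x : ℝ => (1 + x) ^ r - (1 - x) ^ r - 2 * r * x)
      (Set.Icc 0 1) := by
    refine monotoneOn_of_hasDerivWithinAt_nonneg (convex_Icc 0 1)
      (f' := fun x => r * (1 + x) ^ (r - 1) + r * (1 - x) ^ (r - 1) - 2 * r) ?_ ?_ ?_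
    · refine ContinuousOn.sub (ContinuousOn.sub ?_ ?_) (by fun_prop)
      · exact ContinuousOn.rpow_const (by fun_prop) fun _ _ => Or.inr hr.le
      · exact ContinuousOn.rpow_const (by fun_prop) fun _ _ => Or.inr hr.le
    · intro y hy
      rw [interior_Icc] at hy
      have h1 : HasDerivAt (fun x : ℝ => (1 + x) ^ r) (1 * r * (1 + y) ^ (r - 1)) y :=
        ((hasDerivAt_id y).const_add 1).rpow_const (Or.inl (by simp; linarith [hy.1]))
      have h2 : HasDerivAt (fun x : ℝ => (1 - x) ^ r) (-1 * r * (1 - y) ^ (r - 1)) y :=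
        ((hasDerivAt_id y).const_sub 1).rpow_const (Or.inl (by simp; linarith [hy.2]))
      have h3 : HasDerivAt (fun x : ℝ => 2 * r * x) (2 * r * 1) y :=
        (hasDerivAt_id y).const_mul (2 * r)
      exact (((h1.sub h2).sub h3).congr_deriv (by ring)).hasDerivWithinAt
    · intro y hy
      rw [interior_Icc] at hy
      have hp : 0 < 1 + y := by linarith [hy.1]
      have hm : 0 < 1 - y := by linarith [hy.2]
      have hprod : 1 ≤ (1 + y) ^ (r - 1) * (1 - y) ^ (r - 1) := by
        rw [← Real.mul_rpow hp.le hm.le]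
        exact Real.one_le_rpow_of_pos_of_le_one_of_nonpos (by positivity)
          (by nlinarith [sq_nonneg y]) (by linarith)
      have hX := Real.rpow_pos_of_pos hp (r - 1)
      have hY := Real.rpow_pos_of_pos hm (r - 1)
      have : 2 ≤ (1 + y) ^ (r - 1) + (1 - y) ^ (r - 1) := by
        nlinarith [sq_nonneg ((1 + y) ^ (r - 1) - (1 - y) ^ (r - 1))]
      nlinarith
  have := hmono (Set.left_mem_Icc.2 zero_le_one) hx hx.1
  norm_num at this
  linarith

theorem two_add_mul_sq_le_rpow_one_add_add_rpow_one_sub {p x : ℝ} (hp1 : 1 < p) (hp2 : p ≤ 2)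
    (hx : x ∈ Set.Icc (0 : ℝ) 1) :
    2 + p * (p - 1) * x ^ 2 ≤ (1 + x) ^ p + (1 - x) ^ p := by
  have hmono : MonotoneOn (fun x : ℝ => (1 + x) ^ p + (1 - x) ^ p - p * (p - 1) * x ^ 2)
      (Set.Icc 0 1) := by
    refine monotoneOn_of_hasDerivWithinAt_nonneg (convex_Icc 0 1)
      (f' := fun x => p * ((1 + x) ^ (p - 1) - (1 - x) ^ (p - 1) - 2 * (p - 1) * x)) ?_ ?_ ?_
    · refine ContinuousOn.sub (ContinuousOn.add ?_ ?_) (by fun_prop)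
      · exact ContinuousOn.rpow_const (by fun_prop) fun _ _ => Or.inr (by linarith)
      · exact ContinuousOn.rpow_const (by fun_prop) fun _ _ => Or.inr (by linarith)
    · intro y _
      have h1 : HasDerivAt (fun x : ℝ => (1 + x) ^ p) (1 * p * (1 + y) ^ (p - 1)) y :=
        ((hasDerivAt_id y).const_add 1).rpow_const (Or.inr hp1.le)
      have h2 : HasDerivAt (fun x : ℝ => (1 - x) ^ p) (-1 * p * (1 - y) ^ (p - 1)) y :=
        ((hasDerivAt_id y).const_sub 1).rpow_const (Or.inr hp1.le)
      have h3 : HasDerivAt (fun x : ℝ => p * (p - 1) * x ^ 2) (p * (p - 1) * (2 * y)) y := by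
        simpa using (hasDerivAt_pow 2 y).const_mul (p * (p - 1))
      exact (((h1.add h2).sub h3).congr_deriv (by ring)).hasDerivWithinAt
    · intro y hy
      have := two_mul_le_rpow_one_add_sub_rpow_one_sub (r := p - 1) (by linarith) (by linarith)
        (interior_subset hy)
      exact mul_nonneg (by linarith) (by linarith)
  have := hmono (Set.left_mem_Icc.2 zero_le_one) hx hx.1
  norm_num at this
  linarith

/-- The two-point hypercontractive inequality on the real line. -/
theorem sq_add_mul_sq_rpow_le_abs_add_rpow_add_abs_sub_rpow {p : ℝ} (hp1 : 1 < p) (hp2 : p ≤ 2)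
    (s t : ℝ) :
    2 * (s ^ 2 + (p - 1) * t ^ 2) ^ (p / 2) ≤ |s + t| ^ p + |s - t| ^ p := by
  wlog h : |t| ≤ |s| generalizing s t
  · have h' : |s| ≤ |t| := (not_le.1 h).le
    have hst := this t s h'
    rw [add_comm t s, abs_sub_comm t s] at hst
    refine le_trans ?_ hst
    have hsq : s ^ 2 ≤ t ^ 2 := sq_le_sq.2 h'
    have hp : 0 ≤ p - 1 := by linarith
    have : s ^ 2 + (p - 1) * t ^ 2 ≤ t ^ 2 + (p - 1) * s ^ 2 := by nlinarith
    gcongr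
  rcases eq_or_ne s 0 with rfl | hs
  · obtain rfl : t = 0 := by simpa using h
    simp [Real.zero_rpow (show p / 2 ≠ 0 by linarith), Real.zero_rpow (show p ≠ 0 by linarith)]
  have hs' : 0 < |s| := abs_pos.2 hs
  set x := |t / s| with hx
  have hx01 : x ∈ Set.Icc (0 : ℝ) 1 :=
    ⟨abs_nonneg _, by rw [hx, abs_div]; exact div_le_one_of_le₀ h hs'.le⟩
  have hxsq : x ^ 2 = (t / s) ^ 2 := sq_abs _
  have hadd : |s + t| ^ p + |s - t| ^ p = |s| ^ p * ((1 + x) ^ p + (1 - x) ^ p) := by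
    have e1 : |s + t| ^ p = |s| ^ p * |1 + t / s| ^ p := by
      rw [← Real.mul_rpow hs'.le (abs_nonneg _), ← abs_mul]; congr 2; field_simp
    have e2 : |s - t| ^ p = |s| ^ p * |1 - t / s| ^ p := by
      rw [← Real.mul_rpow hs'.le (abs_nonneg _), ← abs_mul]; congr 2; field_simp
    have f1 : |1 + x| = 1 + x := abs_of_nonneg (by linarith [hx01.1])
    have f2 : |1 - x| = 1 - x := abs_of_nonneg (by linarith [hx01.2])
    rw [e1, e2, ← f1, ← f2, ← mul_add]
    rcases abs_choice (t / s) with h | h <;> rw [hx, h]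
    rw [sub_neg_eq_add, ← sub_eq_add_neg, add_comm (|1 - t / s| ^ p)]
  have hsqr : (s ^ 2 + (p - 1) * t ^ 2) ^ (p / 2) =
      |s| ^ p * (1 + (p - 1) * x ^ 2) ^ (p / 2) := by
    have e : |s| ^ p = (s ^ 2) ^ (p / 2) := by
      rw [← sq_abs, ← Real.rpow_natCast_mul hs'.le]; congr 1; push_cast; ring
    have hp : 0 ≤ p - 1 := by linarith
    rw [e, ← Real.mul_rpow (by positivity) (by positivity), hxsq]
    congr 1; field_simp
  have hbern := rpow_one_add_le_one_add_mul_self (s := (p - 1) * x ^ 2) (p := p / 2)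
    (by nlinarith [sq_nonneg x]) (by linarith) (by linarith)
  have hmain := two_add_mul_sq_le_rpow_one_add_add_rpow_one_sub hp1 hp2 hx01
  rw [hadd, hsqr, mul_left_comm]
  exact mul_le_mul_of_nonneg_left (by linarith) (by positivity)

/-- The triangle inequality for integrals of functions with values in the plane with its
`ℓ^q` norm. -/
theorem add_rpow_integral_le_integral_add_rpow {α : Type*} [MeasurableSpace α] {μ : Measure α}
    {q : ℝ} (hq : 1 ≤ q) {f g : α → ℝ} (hf : Integrable f μ) (hg : Integrable g μ) :
    (|∫ x, f x ∂μ| ^ q + |∫ x, g x ∂μ| ^ q) ^ (1 / q) ≤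
      ∫ x, (|f x| ^ q + |g x| ^ q) ^ (1 / q) ∂μ := by
  have hq0 : 0 < q := by linarith
  have : Fact (1 ≤ ENNReal.ofReal q) := ⟨by simpa using hq⟩
  have htoReal : (ENNReal.ofReal q).toReal = q := ENNReal.toReal_ofReal hq0.le
  have hnorm : ∀ z : WithLp (ENNReal.ofReal q) (ℝ × ℝ),
      ‖z‖ = (|z.fst| ^ q + |z.snd| ^ q) ^ (1 / q) := fun z => by
    rw [WithLp.prod_norm_eq_add (by rwa [htoReal]), htoReal]; rfl
  let L := (WithLp.prodContinuousLinearEquiv (ENNReal.ofReal q) ℝ ℝ ℝ).symm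
  have hint : ∫ x, L (f x, g x) ∂μ = L (∫ x, f x ∂μ, ∫ x, g x ∂μ) := by
    rw [← integral_pair hf hg]
    exact L.integral_comp_comm _
  have := norm_integral_le_integral_norm (μ := μ) fun x => L (f x, g x)
  rw [hint] at this
  simp only [hnorm] at this
  exact this

theorem Real.rpow_add_le_two_rpow_mul_add_rpow {x y q : ℝ} (hx : 0 ≤ x) (hy : 0 ≤ y)
    (hq : 1 ≤ q) : (x + y) ^ q ≤ 2 ^ (q - 1) * (x ^ q + y ^ q) := by
  lift x to NNReal using hx
  lift y to NNReal using hy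
  exact_mod_cast NNReal.rpow_add_le_mul_rpow_add_rpow x y hq

theorem Lp_norm_sq_eq_integral_rpow {α : Type*} [MeasurableSpace α] {μ : Measure α} {p : ℝ}
    (hp : 0 < p) (f : Lp ℝ (ENNReal.ofReal p) μ) :
    ‖f‖ ^ 2 = (∫ x, |f x| ^ p ∂μ) ^ (2 / p) := by
  have hI : 0 ≤ ∫ x, |f x| ^ p ∂μ := integral_nonneg fun _ => by positivity
  rw [Lp.norm_def, (Lp.memLp f).eLpNorm_eq_integral_rpow_norm (by simpa) (by simp),
    ENNReal.toReal_ofReal hp.le]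
  simp only [Real.norm_eq_abs]
  rw [ENNReal.toReal_ofReal (by positivity), ← Real.rpow_mul_natCast hI]
  congr 1
  push_cast
  ring

/-- **Two-point uniform convexity of `L_p`, `1 < p ≤ 2` (Ball–Carlen–Lieb).**
For `a, b ∈ L_p`: `‖a+b‖² + (p−1)‖a−b‖² ≤ 2(‖a‖² + ‖b‖²)`. -/
theorem Lp_two_point_uniform_convexity
    {α : Type*} [MeasurableSpace α] (μ : Measure α) (p : ℝ)
    (hp1 : 1 < p) (hp2 : p ≤ 2)
    (a b : Lp ℝ (ENNReal.ofReal p) μ) :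
    ‖a + b‖ ^ 2 + (p - 1) * ‖a - b‖ ^ 2 ≤ 2 * (‖a‖ ^ 2 + ‖b‖ ^ 2) := by
  have hp0 : 0 < p := by linarith
  have hc : 0 ≤ p - 1 := by linarith
  have hq : 1 ≤ 2 / p := by rwa [le_div_iff₀ hp0, one_mul]
  have hcancel : ∀ y : ℝ, 0 ≤ y → (y ^ (p / 2)) ^ (2 / p) = y := fun y hy => by
    rw [← Real.rpow_mul hy, show p / 2 * (2 / p) = 1 by field_simp, Real.rpow_one]
  have hint : ∀ f : Lp ℝ (ENNReal.ofReal p) μ, Integrable (fun x => |f x| ^ p) μ := fun f => by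
    simpa [ENNReal.toReal_ofReal hp0.le] using
      (Lp.memLp f).integrable_norm_rpow (by simpa) (by simp)
  have hI : ∀ f : Lp ℝ (ENNReal.ofReal p) μ, 0 ≤ ∫ x, |f x| ^ p ∂μ := fun f =>
    integral_nonneg fun _ => by positivity
  have hpt : ∀ᵐ x ∂μ, (|(|(a + b) x| ^ p)| ^ (2 / p) +
      |(p - 1) ^ (p / 2) * |(a - b) x| ^ p| ^ (2 / p)) ^ (1 / (2 / p)) ≤
      2 ^ (p - 1) * (|a x| ^ p + |b x| ^ p) := by
    filter_upwards [Lp.coeFn_add a b, Lp.coeFn_sub a b] with x hadd hsub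
    have hsq : ∀ y : ℝ, (|y| ^ p) ^ (2 / p) = y ^ 2 := fun y => by
      rw [← Real.rpow_mul (abs_nonneg y), show p * (2 / p) = (2 : ℕ) by field_simp; norm_num,
        Real.rpow_natCast, sq_abs]
    have hscalar := sq_add_mul_sq_rpow_le_abs_add_rpow_add_abs_sub_rpow hp1 hp2
      (a x + b x) (a x - b x)
    rw [show a x + b x + (a x - b x) = 2 * a x by ring,
      show a x + b x - (a x - b x) = 2 * b x by ring, abs_mul, abs_mul, abs_two,
      Real.mul_rpow zero_le_two (abs_nonneg _), Real.mul_rpow zero_le_two (abs_nonneg _)] at hscalar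
    have htwo : (2 : ℝ) ^ p = 2 * 2 ^ (p - 1) := by
      rw [Real.rpow_sub_one two_ne_zero]; ring
    rw [hadd, hsub, Pi.add_apply, Pi.sub_apply, abs_of_nonneg (a := |_| ^ p) (by positivity),
      abs_of_nonneg (a := _ * _) (by positivity), Real.mul_rpow (by positivity) (by positivity),
      hcancel _ hc, hsq, hsq, one_div_div]
    rw [htwo] at hscalar
    linarith
  have hmink := add_rpow_integral_le_integral_add_rpow hq (hint (a + b))
    ((hint (a - b)).const_mul ((p - 1) ^ (p / 2)))
  have hle := hmink.trans (integral_mono_of_nonneg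
    (Filter.Eventually.of_forall fun _ => by positivity)
    (((hint a).add (hint b)).const_mul (2 ^ (p - 1))) hpt)
  simp only [Pi.add_apply] at hle
  rw [integral_const_mul, integral_const_mul, integral_add (hint a) (hint b),
    abs_of_nonneg (hI _), abs_of_nonneg (mul_nonneg (by positivity) (hI _)),
    Real.mul_rpow (by positivity) (hI _), hcancel _ hc, one_div_div] at hle
  have hpow := Real.rpow_le_rpow (by have := hI (a + b); have := hI (a - b); positivity) hle
    (show 0 ≤ 2 / p by positivity)
  rw [hcancel _ (by have := hI (a + b); have := hI (a - b); positivity),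
    Real.mul_rpow (by positivity) (add_nonneg (hI a) (hI b))] at hpow
  have hmean := Real.rpow_add_le_two_rpow_mul_add_rpow (hI a) (hI b) hq
  simp only [Lp_norm_sq_eq_integral_rpow hp0]
  refine hpow.trans ((mul_le_mul_of_nonneg_left hmean (by positivity)).trans_eq ?_)
  rw [← mul_assoc, ← Real.rpow_mul zero_le_two, ← Real.rpow_add two_pos,
    show (p - 1) * (2 / p) + (2 / p - 1) = 1 by field_simp; ring, Real.rpow_one]
end

section
/- Fix 1 < p ≤ 2 and let x, y, z, w ∈ L_p. Then ‖y−z‖_p² + (p−1)·(‖y − 2x + z‖_p² + ‖y − 2w + z‖_p²)/2 ≤ ‖x−y‖_p² + ‖y−w‖_p² + ‖w−z‖_p² + ‖z−x‖_p². -/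
open MeasureTheory

lemma two_le_rpow_one_add_add_rpow_one_sub {s t : ℝ} (hs : s ≤ 0) (ht0 : 0 < t) (ht1 : t < 1) :
    2 ≤ (1 + t) ^ s + (1 - t) ^ s := by
  have hprod : 1 ≤ (1 + t) ^ s * (1 - t) ^ s := by
    rw [← Real.mul_rpow (by linarith) (by linarith)]
    exact Real.one_le_rpow_of_pos_of_le_one_of_nonpos (by nlinarith) (by nlinarith) hs
  have h1 : 0 < (1 + t) ^ s := Real.rpow_pos_of_pos (by linarith) s
  have h2 : 0 < (1 - t) ^ s := Real.rpow_pos_of_pos (by linarith) s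
  nlinarith [sq_nonneg ((1 + t) ^ s - (1 - t) ^ s)]

lemma hasDerivAt_rpow_one_add (r : ℝ) {t : ℝ} (ht : -1 < t) :
    HasDerivAt (fun t : ℝ => (1 + t) ^ r) (r * (1 + t) ^ (r - 1)) t := by
  have h := ((hasDerivAt_id t).const_add 1).rpow_const (p := r) (Or.inl (by simp; linarith))
  simpa using h

lemma hasDerivAt_rpow_one_sub (r : ℝ) {t : ℝ} (ht : t < 1) :
    HasDerivAt (fun t : ℝ => (1 - t) ^ r) (-(r * (1 - t) ^ (r - 1))) t := by
  have h := ((hasDerivAt_id t).const_sub 1).rpow_const (p := r) (Or.inl (by simp; linarith))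
  simpa using h

lemma two_mul_mul_le_rpow_one_add_sub_rpow_one_sub {q t : ℝ} (hq0 : 0 ≤ q) (hq1 : q ≤ 1)
    (ht0 : 0 ≤ t) (ht1 : t ≤ 1) : 2 * q * t ≤ (1 + t) ^ q - (1 - t) ^ q := by
  have hmono : MonotoneOn (fun t : ℝ => (1 + t) ^ q - (1 - t) ^ q - 2 * q * t) (Set.Icc 0 1) := by
    refine monotoneOn_of_hasDerivWithinAt_nonneg (convex_Icc 0 1)
      (f' := fun t => q * (1 + t) ^ (q - 1) - -(q * (1 - t) ^ (q - 1)) - 2 * q * 1) ?_ ?_ ?_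
    · exact Continuous.continuousOn (by fun_prop (disch := assumption))
    · intro u hu
      rw [interior_Icc] at hu
      exact (((hasDerivAt_rpow_one_add q (by linarith [hu.1])).sub
        (hasDerivAt_rpow_one_sub q hu.2)).sub
          ((hasDerivAt_id u).const_mul (2 * q))).hasDerivWithinAt
    · intro u hu
      rw [interior_Icc] at hu
      nlinarith [two_le_rpow_one_add_add_rpow_one_sub (sub_nonpos.2 hq1) hu.1 hu.2]
  have h := hmono (by simp) ⟨ht0, ht1⟩ ht0
  simp only [add_zero, sub_zero, mul_zero, sub_self] at h
  linarith

lemma two_add_le_rpow_one_add_add_rpow_one_sub {p t : ℝ} (hp1 : 1 ≤ p) (hp2 : p ≤ 2)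
    (ht0 : 0 ≤ t) (ht1 : t ≤ 1) :
    2 + p * (p - 1) * t ^ 2 ≤ (1 + t) ^ p + (1 - t) ^ p := by
  have hmono : MonotoneOn (fun t : ℝ => (1 + t) ^ p + (1 - t) ^ p - p * (p - 1) * t ^ 2)
      (Set.Icc 0 1) := by
    have hp0 : 0 ≤ p := by linarith
    refine monotoneOn_of_hasDerivWithinAt_nonneg (convex_Icc 0 1)
      (f' := fun t => p * (1 + t) ^ (p - 1) + -(p * (1 - t) ^ (p - 1))
        - p * (p - 1) * (2 * t)) ?_ ?_ ?_
    · exact Continuous.continuousOn (by fun_prop (disch := assumption))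
    · intro u hu
      rw [interior_Icc] at hu
      have hsq : HasDerivAt (fun t : ℝ => t ^ 2) (2 * u) u := by simpa using hasDerivAt_pow 2 u
      exact (((hasDerivAt_rpow_one_add p (by linarith [hu.1])).add
        (hasDerivAt_rpow_one_sub p hu.2)).sub (hsq.const_mul (p * (p - 1)))).hasDerivWithinAt
    · intro u hu
      rw [interior_Icc] at hu
      nlinarith [two_mul_mul_le_rpow_one_add_sub_rpow_one_sub (q := p - 1) (by linarith)
        (by linarith) hu.1.le hu.2.le]
  have h := hmono (by simp) ⟨ht0, ht1⟩ ht0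
  norm_num at h
  linarith

lemma sq_rpow_half {a p : ℝ} (ha : 0 ≤ a) : (a ^ 2) ^ (p / 2) = a ^ p := by
  rw [← Real.rpow_natCast_mul ha]
  congr 1
  push_cast
  ring

lemma two_point_inequality_of_le {p a b : ℝ} (hp1 : 1 ≤ p) (hp2 : p ≤ 2) (hb : 0 ≤ b)
    (hba : b ≤ a) :
    (a ^ 2 + (p - 1) * b ^ 2) ^ (p / 2) ≤ ((a + b) ^ p + (a - b) ^ p) / 2 := by
  rcases (hb.trans hba).eq_or_lt with rfl | ha
  · obtain rfl : b = 0 := le_antisymm hba hb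
    have hp : p ≠ 0 := by linarith
    simp [hp]
  have ht0 : 0 ≤ b / a := by positivity
  have ht1 : b / a ≤ 1 := (div_le_one ha).2 hba
  have hkey : (1 + (p - 1) * (b / a) ^ 2) ^ (p / 2)
      ≤ ((1 + b / a) ^ p + (1 - b / a) ^ p) / 2 := by
    have h1 := rpow_one_add_le_one_add_mul_self (s := (p - 1) * (b / a) ^ 2) (p := p / 2)
      (by nlinarith [mul_nonneg (sub_nonneg.2 hp1) (sq_nonneg (b / a))]) (by linarith)
      (by linarith)
    linarith [two_add_le_rpow_one_add_add_rpow_one_sub hp1 hp2 ht0 ht1]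
  have hl : (a ^ 2 + (p - 1) * b ^ 2) ^ (p / 2)
      = a ^ p * (1 + (p - 1) * (b / a) ^ 2) ^ (p / 2) := by
    rw [← sq_rpow_half ha.le, ← Real.mul_rpow (by positivity)
      (by nlinarith [mul_nonneg (sub_nonneg.2 hp1) (sq_nonneg (b / a))])]
    congr 1
    field_simp
  have hadd : (a + b) ^ p = a ^ p * (1 + b / a) ^ p := by
    rw [← Real.mul_rpow ha.le (by linarith)]
    congr 1
    field_simp
  have hsub : (a - b) ^ p = a ^ p * (1 - b / a) ^ p := by
    rw [← Real.mul_rpow ha.le (by linarith)]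
    congr 1
    field_simp
  rw [hl, hadd, hsub, ← mul_add, mul_div_assoc]
  exact mul_le_mul_of_nonneg_left hkey (by positivity)

/-- The two-point inequality of Bonami and Gross. -/
lemma two_point_inequality {p : ℝ} (hp1 : 1 ≤ p) (hp2 : p ≤ 2) (a b : ℝ) :
    (a ^ 2 + (p - 1) * b ^ 2) ^ (p / 2) ≤ (|a + b| ^ p + |a - b| ^ p) / 2 := by
  wlog ha : 0 ≤ a generalizing a
  · have h := this (-a) (by linarith)
    rw [neg_sq, show -a + b = -(a - b) by ring, show -a - b = -(a + b) by ring, abs_neg,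
      abs_neg] at h
    linarith
  wlog hb : 0 ≤ b generalizing b
  · have h := this (-b) (by linarith)
    rw [neg_sq, ← sub_eq_add_neg, sub_neg_eq_add] at h
    linarith
  rw [abs_of_nonneg (add_nonneg ha hb)]
  rcases le_total b a with h | h
  · rw [abs_of_nonneg (sub_nonneg.2 h)]
    exact two_point_inequality_of_le hp1 hp2 hb h
  · rw [abs_sub_comm, abs_of_nonneg (sub_nonneg.2 h), add_comm a b]
    refine le_trans (Real.rpow_le_rpow ?_ ?_ (by linarith))
      (two_point_inequality_of_le hp1 hp2 ha h)
    · nlinarith [mul_nonneg (sub_nonneg.2 hp1) (sq_nonneg b), sq_nonneg a]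
    · nlinarith [mul_nonneg (sub_nonneg.2 hp2) (mul_nonneg (sub_nonneg.2 h) (add_nonneg ha hb))]

/-- Hölder's inequality for two pairs of nonnegative numbers. -/
lemma rpow_mul_rpow_add_le {θ s t S T : ℝ} (hθ0 : 0 < θ) (hθ1 : θ ≤ 1) (hs : 0 ≤ s) (ht : 0 ≤ t)
    (hS : 0 ≤ S) (hT : 0 ≤ T) (hST : 0 < S + T) :
    s ^ θ * S ^ (1 - θ) + t ^ θ * T ^ (1 - θ) ≤ (s + t) ^ θ * (S + T) ^ (1 - θ) := by
  rcases (add_nonneg hs ht).eq_or_lt with h | hst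
  · obtain rfl : s = 0 := by linarith
    obtain rfl : t = 0 := by linarith
    simp [hθ0.ne']
  have hfac : ∀ u U : ℝ, 0 ≤ u → 0 ≤ U → u ^ θ * U ^ (1 - θ)
      ≤ (s + t) ^ θ * (S + T) ^ (1 - θ) * (θ * (u / (s + t)) + (1 - θ) * (U / (S + T))) := by
    intro u U hu hU
    have h := Real.geom_mean_le_arith_mean2_weighted hθ0.le (sub_nonneg.2 hθ1)
      (div_nonneg hu hst.le) (div_nonneg hU hST.le) (by ring)
    have hpos : 0 < (s + t) ^ θ * (S + T) ^ (1 - θ) := by positivity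
    rw [Real.div_rpow hu hst.le, Real.div_rpow hU hST.le, div_mul_div_comm,
      div_le_iff₀ hpos] at h
    linarith
  refine (add_le_add (hfac s S hs hS) (hfac t T ht hT)).trans_eq ?_
  field_simp
  ring

lemma Lp_norm_rpow_eq_integral {α : Type*} [MeasurableSpace α] {μ : Measure α} {p : ℝ}
    (hp : 0 < p) (f : Lp ℝ (ENNReal.ofReal p) μ) : ‖f‖ ^ p = ∫ a, |f a| ^ p ∂μ := by
  have h0 : ENNReal.ofReal p ≠ 0 := by simpa using hp
  have hint : 0 ≤ ∫ a, |f a| ^ p ∂μ := integral_nonneg fun a => by positivity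
  rw [Lp.norm_def, (Lp.memLp f).eLpNorm_eq_integral_rpow_norm h0 ENNReal.ofReal_ne_top,
    ENNReal.toReal_ofReal hp.le]
  simp only [Real.norm_eq_abs]
  rw [ENNReal.toReal_ofReal (by positivity), Real.rpow_inv_rpow hint hp.ne']

lemma Lp_integrable_abs_rpow {α : Type*} [MeasurableSpace α] {μ : Measure α} {p : ℝ}
    (hp : 0 < p) (f : Lp ℝ (ENNReal.ofReal p) μ) : Integrable (fun a => |f a| ^ p) μ := by
  have h := (Lp.memLp f).integrable_norm_rpow (by simpa using hp) ENNReal.ofReal_ne_top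
  simpa only [Real.norm_eq_abs, ENNReal.toReal_ofReal hp.le] using h

/-- The sharp 2-uniform convexity inequality of Ball, Carlen and Lieb. -/
lemma Lp_two_uniform_convexity {α : Type*} [MeasurableSpace α] {μ : Measure α} {p : ℝ}
    (hp1 : 1 < p) (hp2 : p ≤ 2) (f g : Lp ℝ (ENNReal.ofReal p) μ) :
    ‖f‖ ^ 2 + (p - 1) * ‖g‖ ^ 2 ≤ (‖f + g‖ ^ 2 + ‖f - g‖ ^ 2) / 2 := by
  have : Fact (1 ≤ ENNReal.ofReal p) := ⟨by simpa using hp1.le⟩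
  have hp0 : 0 < p := by linarith
  have hc : 0 < p - 1 := by linarith
  set S := ‖f‖ ^ 2 + (p - 1) * ‖g‖ ^ 2 with hSdef
  have hS0 : 0 ≤ S := by positivity
  rcases hS0.eq_or_lt with hS | hS
  · rw [← hS]
    positivity
  have hpt : ∀ᵐ a ∂μ, |f a| ^ p * ‖f‖ ^ (2 - p) + (p - 1) * ‖g‖ ^ (2 - p) * |g a| ^ p
      ≤ S ^ (1 - p / 2) / 2 * (|(f + g) a| ^ p + |(f - g) a| ^ p) := by
    filter_upwards [Lp.coeFn_add f g, Lp.coeFn_sub f g] with a hadd hsub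
    rw [hadd, hsub, Pi.add_apply, Pi.sub_apply]
    have h := rpow_mul_rpow_add_le (θ := p / 2) (s := f a ^ 2) (t := (p - 1) * g a ^ 2)
      (S := ‖f‖ ^ 2) (T := (p - 1) * ‖g‖ ^ 2) (by linarith) (by linarith) (by positivity)
      (by positivity) (by positivity) (by positivity) hS
    have hexp : 1 - p / 2 = (2 - p) / 2 := by ring
    have hcc : (p - 1) ^ (p / 2) * (p - 1) ^ ((2 - p) / 2) = p - 1 := by
      rw [← Real.rpow_add hc, show p / 2 + (2 - p) / 2 = 1 by ring, Real.rpow_one]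
    have h2 := mul_le_mul_of_nonneg_right (two_point_inequality hp1.le hp2 (f a) (g a))
      (Real.rpow_nonneg hS0 (1 - p / 2))
    rw [← hSdef] at h
    rw [Real.mul_rpow hc.le (by positivity), Real.mul_rpow hc.le (by positivity)] at h
    have hl : (f a ^ 2) ^ (p / 2) * (‖f‖ ^ 2) ^ (1 - p / 2)
        + (p - 1) ^ (p / 2) * (g a ^ 2) ^ (p / 2)
          * ((p - 1) ^ (1 - p / 2) * (‖g‖ ^ 2) ^ (1 - p / 2))
        = |f a| ^ p * ‖f‖ ^ (2 - p) + (p - 1) * ‖g‖ ^ (2 - p) * |g a| ^ p := by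
      rw [hexp, ← sq_abs (f a), ← sq_abs (g a), sq_rpow_half (abs_nonneg _),
        sq_rpow_half (abs_nonneg _), sq_rpow_half (norm_nonneg _), sq_rpow_half (norm_nonneg _)]
      linear_combination |g a| ^ p * ‖g‖ ^ (2 - p) * hcc
    rw [hl] at h
    linarith
  have hF := Lp_integrable_abs_rpow hp0 f
  have hG := Lp_integrable_abs_rpow hp0 g
  have hA := Lp_integrable_abs_rpow hp0 (f + g)
  have hB := Lp_integrable_abs_rpow hp0 (f - g)
  have hint := integral_mono_ae ((hF.mul_const _).add (hG.const_mul _))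
    ((hA.add hB).const_mul _) hpt
  simp only [Pi.add_apply] at hint
  rw [integral_add (hF.mul_const _) (hG.const_mul _), integral_mul_const, integral_const_mul,
    integral_const_mul, integral_add hA hB] at hint
  simp only [← Lp_norm_rpow_eq_integral hp0] at hint
  have hsq : ∀ h : Lp ℝ (ENNReal.ofReal p) μ, ‖h‖ ^ p * ‖h‖ ^ (2 - p) = ‖h‖ ^ 2 := by
    intro h
    rw [← Real.rpow_add' (norm_nonneg h) (by norm_num), add_sub_cancel, Real.rpow_two]
  have hle : S ≤ S ^ (1 - p / 2) * ((‖f + g‖ ^ p + ‖f - g‖ ^ p) / 2) := by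
    have hSeq : S = ‖f‖ ^ p * ‖f‖ ^ (2 - p) + (p - 1) * ‖g‖ ^ (2 - p) * ‖g‖ ^ p := by
      rw [hSdef, ← hsq f, ← hsq g]
      ring
    linarith
  have hpow : S ^ (p / 2) ≤ (‖f + g‖ ^ p + ‖f - g‖ ^ p) / 2 := by
    have hmul : S ^ (1 - p / 2) * S ^ (p / 2) = S := by
      rw [← Real.rpow_add hS, sub_add_cancel, Real.rpow_one]
    refine le_of_mul_le_mul_left ?_ (Real.rpow_pos_of_pos hS (1 - p / 2))
    rwa [hmul]
  have hmean : (‖f + g‖ ^ p + ‖f - g‖ ^ p) / 2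
      ≤ ((‖f + g‖ ^ 2 + ‖f - g‖ ^ 2) / 2) ^ (p / 2) := by
    have hconc := Real.concaveOn_rpow (p := p / 2) (by linarith) (by linarith)
    have h := hconc.2 (Set.mem_Ici.2 (sq_nonneg ‖f + g‖)) (Set.mem_Ici.2 (sq_nonneg ‖f - g‖))
      one_half_pos.le one_half_pos.le (add_halves 1)
    simp only [smul_eq_mul, sq_rpow_half (norm_nonneg _)] at h
    rw [← mul_add, ← mul_add, one_div_mul_eq_div, one_div_mul_eq_div] at h
    exact h
  exact (Real.rpow_le_rpow_iff hS0 (by positivity) (by linarith)).1 (hpow.trans hmean)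

/-- Uniform convexity recentred at a point `x` between `y` and `z`. -/
lemma Lp_midpoint_inequality {α : Type*} [MeasurableSpace α] {μ : Measure α} {p : ℝ}
    (hp1 : 1 < p) (hp2 : p ≤ 2) (x y z : Lp ℝ (ENNReal.ofReal p) μ) :
    ‖y - z‖ ^ 2 + (p - 1) * ‖y - (2 : ℝ) • x + z‖ ^ 2 ≤ 2 * (‖x - y‖ ^ 2 + ‖z - x‖ ^ 2) := by
  have h := Lp_two_uniform_convexity hp1 hp2 (y - z) (y - (2 : ℝ) • x + z)
  have hadd : y - z + (y - (2 : ℝ) • x + z) = (-2 : ℝ) • (x - y) := by module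
  have hsub : y - z - (y - (2 : ℝ) • x + z) = (-2 : ℝ) • (z - x) := by module
  have : Fact (1 ≤ ENNReal.ofReal p) := ⟨by simpa using hp1.le⟩
  rw [hadd, hsub, norm_smul, norm_smul] at h
  norm_num at h
  linarith

/-- **Averaged four-point inequality in `L_p`, `1 < p ≤ 2`.**
For `x, y, z, w ∈ L_p`:
`‖y−z‖² + (p−1)(‖y − 2x + z‖² + ‖y − 2w + z‖²)/2
  ≤ ‖x−y‖² + ‖y−w‖² + ‖w−z‖² + ‖z−x‖²`. -/
theorem Lp_averaged_four_point_inequality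
    {α : Type*} [MeasurableSpace α] (μ : Measure α) (p : ℝ)
    (hp1 : 1 < p) (hp2 : p ≤ 2)
    (x y z w : Lp ℝ (ENNReal.ofReal p) μ) :
    ‖y - z‖ ^ 2 +
      (p - 1) * ((‖y - (2 : ℝ) • x + z‖ ^ 2 + ‖y - (2 : ℝ) • w + z‖ ^ 2) / 2) ≤
      ‖x - y‖ ^ 2 + ‖y - w‖ ^ 2 + ‖w - z‖ ^ 2 + ‖z - x‖ ^ 2 := by
  have : Fact (1 ≤ ENNReal.ofReal p) := ⟨by simpa using hp1.le⟩
  have hx := Lp_midpoint_inequality hp1 hp2 x y z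
  have hw := Lp_midpoint_inequality hp1 hp2 w y z
  rw [norm_sub_rev w y, norm_sub_rev z w] at hw
  linarith
end
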